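/- For each fixed nonnegative integer k, f_{n,k} · 2^{k+1} · (log 2)^{n+1} / n! → 1 as n → ∞, where log denotes the natural logarithm; that is, f_{n,k} ~ n!/(2^{k+1}·(log 2)^{n+1}). -/

import Mathlib

/-- Stirling numbers of the second kind. -/
def S2 : ℕ → ℕ → ℕ
  | 0, 0 => 1
  | 0, _ + 1 => 0
  | _ + 1, 0 => 0
  | n + 1, k + 1 => (k + 1) * S2 n (k + 1) + S2 n k

/-- Generalized Fubini numbers: `f_{n,k} = ∑_{l=k}^n l! · S2(n-k, l-k)`. -/
def genFubini (n k : ℕ) : ℕ :=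
  ∑ l ∈ Finset.Icc k n, Nat.factorial l * S2 (n - k) (l - k)

open Finset Filter Topology

theorem S2_eq_zero_of_lt {n k : ℕ} (h : n < k) : S2 n k = 0 := by
  induction n generalizing k with
  | zero =>
    obtain ⟨j, rfl⟩ := Nat.exists_eq_add_of_lt h
    simp [S2]
  | succ n ih =>
    obtain ⟨j, rfl⟩ : ∃ j, k = j + 1 := ⟨k - 1, by omega⟩
    simp [S2, ih (show n < j + 1 by omega), ih (show n < j by omega)]

theorem sum_choose_mul_S2 (n j : ℕ) :
    ∑ i ∈ range (n + 1), n.choose i * S2 i j = S2 (n + 1) (j + 1) := by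
  induction n generalizing j with
  | zero => cases j <;> simp [S2]
  | succ n ih =>
    have hsplit : ∑ i ∈ range (n + 2), (n + 1).choose i * S2 i j =
        ∑ i ∈ range (n + 1), n.choose i * S2 i j +
          ∑ i ∈ range (n + 1), n.choose i * S2 (i + 1) j := by
      have hext : ∑ i ∈ range (n + 1), n.choose i * S2 i j =
          ∑ i ∈ range (n + 2), n.choose i * S2 i j := by
        rw [sum_range_succ _ (n + 1)]; simp
      rw [hext, sum_range_succ', sum_range_succ' _ (n + 1)]
      simp only [Nat.choose_succ_succ, add_mul, sum_add_distrib, Nat.choose_zero_right]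
      ring
    rw [hsplit, ih]
    cases j with
    | zero => simp [S2]
    | succ j =>
      have hstep : ∑ i ∈ range (n + 1), n.choose i * S2 (i + 1) (j + 1) =
          (j + 1) * S2 (n + 1) (j + 2) + S2 (n + 1) (j + 1) := by
        rw [← ih (j + 1), ← ih j, mul_sum, ← sum_add_distrib]
        refine sum_congr rfl fun i _ => ?_
        simp only [S2]; ring
      have hrec : S2 (n + 1 + 1) (j + 1 + 1) =
          (j + 1 + 1) * S2 (n + 1) (j + 1 + 1) + S2 (n + 1) (j + 1) := rfl
      rw [hstep, hrec]; ring

theorem genFubini_add_eq_sum_range (m k : ℕ) {N : ℕ} (hN : m < N) :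
    genFubini (m + k) k = ∑ j ∈ range N, (j + k).factorial * S2 m j := by
  have hsub : range (m + 1) ⊆ range N := range_subset_range.2 hN
  rw [← sum_subset hsub fun j _ hj => by
    rw [S2_eq_zero_of_lt (by simpa using hj), mul_zero]]
  rw [genFubini, ← Finset.Ico_add_one_right_eq_Icc, sum_Ico_eq_sum_range,
    show m + k + 1 - k = m + 1 by omega]
  refine sum_congr rfl fun j _ => ?_
  rw [Nat.add_sub_cancel, Nat.add_sub_cancel_left, add_comm k j]

theorem two_mul_genFubini_succ (m k : ℕ) :
    2 * genFubini (m + k + 1) (k + 1) =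
      genFubini (m + k + 1) k + (k + 1) * genFubini (m + k) k := by
  have h₁ := genFubini_add_eq_sum_range m (k + 1) (N := m + 2) (by omega)
  have h₁' := genFubini_add_eq_sum_range m (k + 1) (N := m + 1) (by omega)
  have h₂ := genFubini_add_eq_sum_range (m + 1) k (N := m + 2) (by omega)
  have h₃ := genFubini_add_eq_sum_range m k (N := m + 2) (by omega)
  rw [show m + 1 + k = m + k + 1 by ring] at h₂
  rw [← add_assoc] at h₁ h₁'
  rw [two_mul]
  nth_rewrite 1 [h₁]
  rw [h₁', h₂, h₃, sum_range_succ', sum_range_succ' _ (m + 1), sum_range_succ' _ (m + 1)]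
  have hsucc : ∑ j ∈ range (m + 1), (j + 1 + (k + 1)).factorial * S2 m (j + 1) =
      ∑ j ∈ range (m + 1), (j + 1 + k).factorial * ((j + 1) * S2 m (j + 1)) +
        ∑ j ∈ range (m + 1), (k + 1) * ((j + 1 + k).factorial * S2 m (j + 1)) := by
    rw [← sum_add_distrib]
    refine sum_congr rfl fun j _ => ?_
    rw [← add_assoc (j + 1) k 1, Nat.factorial_succ]; ring
  have hshift (j : ℕ) : j + (k + 1) = j + 1 + k := by ring
  simp only [hsucc, mul_add, mul_sum, S2, sum_add_distrib]
  rw [← add_assoc 0 k 1, Nat.factorial_succ]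
  simp only [hshift]
  ring

theorem sum_choose_mul_genFubini_zero (n : ℕ) :
    ∑ i ∈ range (n + 1), n.choose i * genFubini i 0 + (if n = 0 then 1 else 0) =
      2 * genFubini n 0 := by
  have h (i : ℕ) (hi : i < n + 2) := genFubini_add_eq_sum_range i 0 hi
  simp only [add_zero] at h
  have h₁ : ∑ i ∈ range (n + 1), n.choose i * genFubini i 0 =
      ∑ j ∈ range (n + 2), j.factorial * S2 (n + 1) (j + 1) := by
    simp_rw [← sum_choose_mul_S2, mul_sum]
    rw [sum_comm]
    refine sum_congr rfl fun i hi => ?_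
    rw [h i (by have := mem_range.1 hi; omega), mul_sum]
    exact sum_congr rfl fun j _ => by ring
  have h₂ : ∑ j ∈ range (n + 2), (j + 1).factorial * S2 n (j + 1) +
      (if n = 0 then 1 else 0) = genFubini n 0 := by
    have := genFubini_add_eq_sum_range n 0 (N := n + 3) (by omega)
    rw [add_zero, sum_range_succ'] at this
    rw [this]
    cases n <;> simp [S2]
  rw [h₁, two_mul]
  nth_rewrite 1 [← h₂]
  rw [h n (by omega)]
  simp only [S2, mul_add, sum_add_distrib, Nat.factorial_succ]
  rw [add_right_comm]
  congr 2
  exact sum_congr rfl fun j _ => by ring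

/-- Partial sums of the coefficients of the inverse of a power series with constant coefficient
`1`, nonnegative coefficients and coefficient sum `s < 2` converge to `s⁻¹`. -/
theorem tendsto_sum_coeff_of_mul_eq_one {R D : PowerSeries ℝ} {s : ℝ} (hRD : D * R = 1)
    (h0 : PowerSeries.coeff 0 R = 1) (hnn : ∀ n, 0 ≤ PowerSeries.coeff n R)
    (hsum : HasSum (fun n => PowerSeries.coeff n R) s) (hs : s < 2) :
    Tendsto (fun n => ∑ i ∈ range n, PowerSeries.coeff i D) atTop (𝓝 s⁻¹) := by
  set r : ℕ → ℝ := fun n => PowerSeries.coeff n R with hr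
  set d : ℕ → ℝ := fun n => PowerSeries.coeff n D
  have hconv (n : ℕ) : ∑ p ∈ antidiagonal n, d p.1 * r p.2 = if n = 0 then 1 else 0 := by
    rw [← PowerSeries.coeff_mul, hRD, PowerSeries.coeff_one]
  have hd0 : d 0 = 1 := by simpa [show r 0 = 1 from h0] using hconv 0
  have hsucc (n : ℕ) : |d (n + 1)| ≤ ∑ p ∈ antidiagonal n, |d p.1| * r (p.2 + 1) := by
    have h := hconv (n + 1)
    rw [Nat.antidiagonal_succ', sum_cons, sum_map] at h
    simp only [show r 0 = 1 from h0, mul_one, Nat.succ_ne_zero, if_false] at h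
    rw [eq_neg_of_add_eq_zero_left h, abs_neg]
    refine (abs_sum_le_sum_abs _ _).trans (le_of_eq (sum_congr rfl fun p _ => ?_))
    simp [abs_mul, abs_of_nonneg (hnn _), hr]
  have htail (N : ℕ) : ∑ i ∈ range N, r (i + 1) ≤ s - 1 := by
    have := sum_le_hasSum (range (N + 1)) (fun i _ => hnn i) hsum
    rw [sum_range_succ', h0] at this
    linarith
  have hbound (N : ℕ) : ∑ i ∈ range N, |d i| ≤ (2 - s)⁻¹ := by
    have hS0 : 0 ≤ ∑ i ∈ range N, |d i| := sum_nonneg fun _ _ => abs_nonneg _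
    have hle : ∑ n ∈ range N, ∑ p ∈ antidiagonal n, |d p.1| * r (p.2 + 1) ≤
        (∑ i ∈ range N, |d i|) * ∑ i ∈ range N, r (i + 1) := by
      simp_rw [Nat.sum_antidiagonal_eq_sum_range_succ_mk]
      rw [sum_range_diag_flip N fun i j => |d i| * r (j + 1), sum_mul_sum]
      exact sum_le_sum fun i _ => sum_le_sum_of_subset_of_nonneg
        (range_subset_range.2 (Nat.sub_le N i)) fun j _ _ => mul_nonneg (abs_nonneg _) (hnn _)
    have h1 : ∑ i ∈ range N, |d i| ≤ 1 + (∑ i ∈ range N, |d i|) * (s - 1) := by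
      calc ∑ i ∈ range N, |d i| ≤ ∑ i ∈ range (N + 1), |d i| :=
            sum_le_sum_of_subset_of_nonneg (range_subset_range.2 N.le_succ)
              fun _ _ _ => abs_nonneg _
        _ = 1 + ∑ i ∈ range N, |d (i + 1)| := by rw [sum_range_succ', hd0, abs_one, add_comm]
        _ ≤ 1 + (∑ i ∈ range N, |d i|) * ∑ i ∈ range N, r (i + 1) := by
            gcongr
            exact (sum_le_sum fun n _ => hsucc n).trans hle
        _ ≤ _ := by gcongr; exact htail N
    rw [← one_div, le_div_iff₀ (by linarith)]
    linarith
  have hdsum : Summable fun n => ‖d n‖ :=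
    summable_of_sum_range_le (fun _ => norm_nonneg _) hbound
  have hrsum : Summable fun n => ‖r n‖ := hsum.summable.norm
  have hprod : (∑' n, d n) * s = 1 := by
    rw [← hsum.tsum_eq, tsum_mul_tsum_eq_tsum_sum_antidiagonal_of_summable_norm hdsum hrsum]
    simp_rw [hconv]
    exact tsum_ite_eq 0 _
  rw [← eq_inv_of_mul_eq_one_left hprod]
  exact hdsum.of_norm.hasSum.tendsto_sum_nat

theorem sum_exp_tail (x c : ℝ) (N : ℕ) :
    ∑ k ∈ range (N + 1), (c - ∑ j ∈ range (k + 1), x ^ j / j.factorial) =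
      (N + 1) * (c - ∑ j ∈ range (N + 1), x ^ j / j.factorial) +
        x * ∑ j ∈ range N, x ^ j / j.factorial := by
  induction N with
  | zero => simp
  | succ N ih =>
    have hp : ((N : ℝ) + 1) * (x ^ (N + 1) / (N + 1).factorial) =
        x * (x ^ N / N.factorial) := by
      rw [Nat.factorial_succ]; push_cast
      have := N.factorial_ne_zero
      field_simp
      ring
    rw [sum_range_succ, ih, sum_range_succ _ (N + 1), sum_range_succ _ N]
    push_cast
    linear_combination hp

theorem hasSum_exp_tail {x : ℝ} (h0 : 0 ≤ x) (h1 : x ≤ 1) :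
    HasSum (fun k : ℕ => Real.exp x - ∑ j ∈ range (k + 1), x ^ j / j.factorial)
      (x * Real.exp x) := by
  have hnn (k : ℕ) : 0 ≤ Real.exp x - ∑ j ∈ range (k + 1), x ^ j / j.factorial :=
    sub_nonneg.2 (Real.sum_le_exp_of_nonneg h0 _)
  rw [hasSum_iff_tendsto_nat_of_nonneg hnn, ← tendsto_add_atTop_iff_nat 1]
  simp_rw [sum_exp_tail]
  have hexp : Tendsto (fun N => ∑ j ∈ range N, x ^ j / j.factorial) atTop (𝓝 (Real.exp x)) := by
    rw [Real.exp_eq_exp_ℝ]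
    exact (NormedSpace.expSeries_div_hasSum_exp x).tendsto_sum_nat
  have hz : Tendsto (fun N : ℕ => ((N : ℝ) + 1) *
      (Real.exp x - ∑ j ∈ range (N + 1), x ^ j / j.factorial)) atTop (𝓝 0) := by
    have hlim : Tendsto (fun N : ℕ => 2 * ((1 : ℝ) ^ N / N.factorial)) atTop (𝓝 0) := by
      simpa using (FloorSemiring.tendsto_pow_div_factorial_atTop (1 : ℝ)).const_mul 2
    refine squeeze_zero (fun N => mul_nonneg (by positivity) (hnn N)) (fun N => ?_) hlim
    have hb := Real.exp_bound (abs_le.2 ⟨by linarith, h1⟩) N.succ_pos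
    have hx : |x| ^ (N + 1) ≤ 1 := pow_le_one₀ (abs_nonneg _) (by rwa [abs_of_nonneg h0])
    have hf : (0 : ℝ) < N.factorial := by positivity
    calc _ ≤ ((N : ℝ) + 1) * (1 * (((N + 1).succ : ℝ) / ((N + 1).factorial * ((N + 1 : ℕ) : ℝ)))) := by
          gcongr
          exact ((le_abs_self _).trans hb).trans (by gcongr)
      _ ≤ _ := by
          rw [Nat.factorial_succ]; push_cast
          rw [one_pow, one_mul, mul_div_assoc', div_le_iff₀ (by positivity)]
          field_simp
          nlinarith
  simpa using hz.add (hexp.const_mul x)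

theorem genFubini_zero_asymptotic :
    Tendsto (fun n : ℕ => (genFubini n 0 : ℝ) * Real.log 2 ^ n / n.factorial) atTop
      (𝓝 (2 * Real.log 2)⁻¹) := by
  set L := Real.log 2
  have hL0 : 0 < L := Real.log_pos one_lt_two
  have hL1 : L < 1 := Real.log_two_lt_d9.trans (by norm_num)
  have hexp : Real.exp L = 2 := Real.exp_log two_pos
  let V : PowerSeries ℝ := .mk fun n => (genFubini n 0 : ℝ) * L ^ n / n.factorial
  let E : PowerSeries ℝ := .mk fun n => L ^ n / n.factorial
  let R : PowerSeries ℝ := (PowerSeries.C 2 - E) * .mk 1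
  have hVE : V * (PowerSeries.C 2 - E) = 1 := by
    ext n
    rw [mul_sub, map_sub, mul_comm V, PowerSeries.coeff_C_mul, PowerSeries.coeff_mul,
      PowerSeries.coeff_one]
    have h := congrArg (Nat.cast (R := ℝ)) (sum_choose_mul_genFubini_zero n)
    push_cast at h
    have hc : ∑ p ∈ antidiagonal n, PowerSeries.coeff p.1 V * PowerSeries.coeff p.2 E =
        (∑ i ∈ range (n + 1), (n.choose i : ℝ) * genFubini i 0) * (L ^ n / n.factorial) := by
      rw [Nat.sum_antidiagonal_eq_sum_range_succ_mk, sum_mul]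
      refine sum_congr rfl fun i hi => ?_
      have hin : i ≤ n := Nat.lt_succ_iff.1 (mem_range.1 hi)
      simp only [V, E, PowerSeries.coeff_mk]
      rw [Nat.cast_choose ℝ hin, ← pow_mul_pow_sub L hin]
      have := n.factorial_ne_zero
      field_simp
    rw [hc, eq_sub_of_add_eq h]
    simp only [V, PowerSeries.coeff_mk]
    rcases eq_or_ne n 0 with rfl | hn
    · simp
    · simp only [hn, if_false]; ring
  have hRcoeff (n : ℕ) : PowerSeries.coeff n R =
      Real.exp L - ∑ j ∈ range (n + 1), L ^ j / j.factorial := by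
    rw [PowerSeries.coeff_mul, Nat.sum_antidiagonal_eq_sum_range_succ_mk, hexp]
    simp [E, PowerSeries.coeff_C, sum_sub_distrib]
  have hRinv : (V * (1 - PowerSeries.X)) * R = 1 := by
    have := PowerSeries.mk_one_mul_one_sub_eq_one ℝ
    linear_combination hVE * (PowerSeries.mk 1 * (1 - PowerSeries.X)) + this
  have hlim := tendsto_sum_coeff_of_mul_eq_one hRinv (by rw [hRcoeff, hexp]; norm_num)
    (fun n => by rw [hRcoeff]; exact sub_nonneg.2 (Real.sum_le_exp_of_nonneg hL0.le _))
    (by simpa only [hRcoeff] using hasSum_exp_tail hL0.le hL1.le) (by rw [hexp]; linarith)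
  rw [hexp, mul_comm L, ← tendsto_add_atTop_iff_nat 1] at hlim
  refine hlim.congr fun n => ?_
  induction n with
  | zero => simp [V]
  | succ n ih =>
    rw [sum_range_succ, ih, mul_sub, mul_one, map_sub, PowerSeries.coeff_succ_mul_X]
    simp only [V, PowerSeries.coeff_mk]
    ring

theorem genFubini_asymptotic (k : ℕ) :
    Filter.Tendsto
      (fun n : ℕ => (genFubini n k : ℝ) * 2 ^ (k + 1) * (Real.log 2) ^ (n + 1) /
        (Nat.factorial n : ℝ))
      Filter.atTop (nhds 1) := by
  have hL0 : 0 < Real.log 2 := Real.log_pos one_lt_two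
  induction k with
  | zero =>
    have h := genFubini_zero_asymptotic.const_mul (2 * Real.log 2)
    rw [mul_inv_cancel₀ (by positivity)] at h
    exact h.congr fun n => by ring
  | succ k ih =>
    have hinv : Tendsto (fun n : ℕ => ((k : ℝ) + 1) * Real.log 2 * (1 / ((n : ℝ) + 1))) atTop
        (𝓝 0) := by
      simpa using tendsto_one_div_add_atTop_nhds_zero_nat.const_mul (((k : ℝ) + 1) * Real.log 2)
    have h := (ih.comp (tendsto_add_atTop_nat 1)).add (hinv.mul ih)
    rw [zero_mul, add_zero] at h
    rw [← tendsto_add_atTop_iff_nat 1]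
    refine h.congr' ?_
    filter_upwards [eventually_ge_atTop k] with n hn
    obtain ⟨m, rfl⟩ := Nat.exists_eq_add_of_le' hn
    have hrec := congrArg (Nat.cast (R := ℝ)) (two_mul_genFubini_succ m k)
    push_cast at hrec
    simp only [Function.comp_apply]
    rw [pow_succ 2 (k + 1), show ∀ a b c : ℝ, a * (b * 2) * c = (2 * a) * b * c by intros; ring,
      hrec, Nat.factorial_succ]
    have := (m + k).factorial_ne_zero
    push_cast
    field_simp
    ring
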